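/- Let A be a real m×n matrix, b ∈ ℝ^m, c ∈ ℝ^n, and let d* be the optimal value of the linear program min{cᵀz : Az = b, z ≥ 0}, assumed finite. Let x be an optimal solution (Ax = b, x ≥ 0, cᵀx = d*) with J₊ = {i : xᵢ > 0}. Then x is the unique least ℓ1-norm optimal solution of the linear program (i.e., the unique minimizer of ‖z‖₁ over {z : Az = b, cᵀz = d*, z ≥ 0}) if and only if (i) the matrix H obtained by appending the row c_{J₊}ᵀ below the column submatrix A_{J₊} has full column rank, and (ii) there exists η in the range space of the matrix [Aᵀ, c] (i.e., η = Aᵀu + βc for some u ∈ ℝ^m, β ∈ ℝ) with ηᵢ = 1 for all i ∈ J₊ and ηᵢ < 1 for all i ∉ J₊. -/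

import Mathlib

open Matrix

/-- If the linear functional `k ↦ ∑ i, k i` is positive at every nonzero `k ∈ ker M` that is
nonnegative off `J`, then the row space of `M` contains a vector equal to `1` on `J` and
less than `1` off `J`. -/
theorem exists_transpose_mulVec_eq_one_lt_one {ι κ : Type*} [Fintype ι] [Fintype κ]
    (M : Matrix ι κ ℝ) (J : κ → Prop)
    (hM : ∀ k : κ → ℝ, M *ᵥ k = 0 → (∀ i, ¬ J i → 0 ≤ k i) → k ≠ 0 → 0 < ∑ i, k i) :
    ∃ y : ι → ℝ, (∀ i, J i → (Mᵀ *ᵥ y) i = 1) ∧ (∀ i, ¬ J i → (Mᵀ *ᵥ y) i < 1) := by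
  classical
  let e : κ → ℝ := fun i => if J i then 1 else 0
  let D : (κ → ℝ) →ₗ[ℝ] (κ → ℝ) := (Matrix.diagonal e).mulVecLin
  have hD : ∀ v i, D v i = if J i then v i else 0 := by
    intro v i
    simp [D, e, Matrix.mulVec_diagonal]
  let P : (ι → ℝ) →ₗ[ℝ] (κ → ℝ) := D ∘ₗ Mᵀ.mulVecLin
  have hP : ∀ y i, P y i = if J i then (Mᵀ *ᵥ y) i else 0 := fun y i => hD _ i
  have hrep : ∀ (f : (κ → ℝ) →ₗ[ℝ] ℝ) (v : κ → ℝ), f v = v ⬝ᵥ fun i => f (Pi.single i 1) := by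
    intro f v
    rw [LinearMap.pi_apply_eq_sum_univ f v]
    simp only [dotProduct, smul_eq_mul]
    refine Finset.sum_congr rfl fun i _ => ?_
    congr 2
    ext j
    simp [Pi.single_apply, eq_comm]
  have hker : ∀ k : κ → ℝ, (∀ y, (Mᵀ *ᵥ y) ⬝ᵥ k = 0) → M *ᵥ k = 0 := by
    intro k hk
    refine dotProduct_eq_zero _ fun y => ?_
    rw [dotProduct_comm, dotProduct_mulVec, ← mulVec_transpose]
    exact hk y
  have hPdot : ∀ y (w : κ → ℝ), P y ⬝ᵥ w = (Mᵀ *ᵥ y) ⬝ᵥ D w := by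
    intro y w
    refine Finset.sum_congr rfl fun i _ => ?_
    rw [hP, hD]
    split_ifs <;> simp
  have hedot : ∀ w : κ → ℝ, e ⬝ᵥ w = ∑ i, D w i := by
    intro w
    refine Finset.sum_congr rfl fun i _ => ?_
    rw [hD]
    by_cases hi : J i <;> simp [e, hi]
  obtain ⟨y₀, hy₀⟩ : e ∈ LinearMap.range P := by
    by_contra hnot
    obtain ⟨f, hf, hfP⟩ := Submodule.exists_le_ker_of_notMem hnot
    set w : κ → ℝ := fun i => f (Pi.single i 1) with hw
    have hsum : ∑ i, D w i ≠ 0 := by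
      rw [← hedot, hw, ← hrep]; exact hf
    have hMk : M *ᵥ D w = 0 := by
      refine hker _ fun y => ?_
      rw [← hPdot, hw, ← hrep]
      exact hfP ⟨y, rfl⟩
    have hne : D w ≠ 0 := by
      intro h; apply hsum; simp [h]
    have h1 := hM (D w) hMk (fun i hi => by rw [hD, if_neg hi]) hne
    have h2 := hM (-D w) (by rw [mulVec_neg, hMk, neg_zero])
      (fun i hi => by rw [Pi.neg_apply, hD, if_neg hi, neg_zero]) (neg_ne_zero.mpr hne)
    simp only [Pi.neg_apply, Finset.sum_neg_distrib] at h2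
    linarith
  by_contra hcon
  let U : Set (κ → ℝ) := {v | ∀ i, ¬ J i → v i < 1}
  let E : Set (κ → ℝ) := Mᵀ.mulVecLin '' (P ⁻¹' {e})
  have hUopen : IsOpen U := by
    have : U = ⋂ i, {v : κ → ℝ | ¬ J i → v i < 1} := by ext v; simp [U]
    rw [this]
    refine isOpen_iInter_of_finite fun i => ?_
    by_cases hi : J i
    · simp [hi]
    · simpa [hi] using isOpen_lt (continuous_apply i) continuous_const
  have hUconv : Convex ℝ U := by
    intro v hv v' hv' a b ha hb hab i hi
    exact convex_Iio (1 : ℝ) (hv i hi) (hv' i hi) ha hb hab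
  have hEconv : Convex ℝ E :=
    ((convex_singleton e).linear_preimage P).linear_image _
  have hdisj : Disjoint U E := by
    rw [Set.disjoint_left]
    rintro v hvU ⟨y, hy, rfl⟩
    refine hcon ⟨y, fun i hi => ?_, hvU⟩
    have := congrFun hy i
    rw [hP, if_pos hi] at this
    simpa [e, hi] using this
  obtain ⟨f, u, hfU, hfE⟩ := geometric_hahn_banach_open hUconv hUopen hEconv hdisj
  set h : κ → ℝ := fun i => f (Pi.single i 1) with hh
  have hf : ∀ v, f v = v ⬝ᵥ h := fun v => hrep f.toLinearMap v
  have hu : 0 < u := by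
    have := hfU 0 (fun i _ => by simp)
    simpa using this
  have hsingle : ∀ i (t : ℝ), (¬ J i → t < 1) → t * h i < u := by
    intro i t ht
    have := hfU (Pi.single i t) (fun j hj => by
      by_cases hji : j = i
      · subst hji; simpa using ht hj
      · simp [hji])
    rwa [hf, single_dotProduct] at this
  have hJ : ∀ i, J i → h i = 0 := by
    intro i hi
    by_contra hne
    have := hsingle i (u / h i) (fun hn => absurd hi hn)
    rw [div_mul_cancel₀ _ hne] at this
    exact lt_irrefl _ this
  have hoff : ∀ i, ¬ J i → 0 ≤ h i := by
    intro i _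
    by_contra! hneg
    have := hsingle i (u / h i) (fun _ => (div_neg_of_pos_of_neg hu hneg).trans one_pos)
    rw [div_mul_cancel₀ _ hneg.ne] at this
    exact lt_irrefl _ this
  have hsum : ∑ i, h i ≤ u := by
    by_contra! hlt
    have hS : 0 < ∑ i, h i := hu.trans hlt
    have := hfU (fun _ => u / ∑ i, h i) (fun i _ => (div_lt_one hS).mpr hlt)
    rw [hf, dotProduct, ← Finset.mul_sum, div_mul_cancel₀ _ hS.ne'] at this
    exact lt_irrefl _ this
  have hann : f.toLinearMap ∘ₗ Mᵀ.mulVecLin ∈ LinearMap.range P.dualMap := by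
    rw [LinearMap.range_dualMap_eq_dualAnnihilator_ker, Submodule.mem_dualAnnihilator]
    intro y hy
    rw [LinearMap.mem_ker] at hy
    -- `f` is bounded below on the line `y₀ + ℝ y`, which is mapped into `E`
    have hline : ∀ t : ℝ, u ≤ f (Mᵀ *ᵥ y₀) + t * f (Mᵀ *ᵥ y) := by
      intro t
      have := hfE (Mᵀ.mulVecLin (y₀ + t • y)) ⟨_, by simp [hy, hy₀], rfl⟩
      simpa [mulVec_transpose] using this
    by_contra hne
    change f (Mᵀ *ᵥ y) ≠ 0 at hne
    have := hline (-f (Mᵀ *ᵥ y₀) / f (Mᵀ *ᵥ y))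
    rw [div_mul_cancel₀ _ hne] at this
    linarith
  obtain ⟨g, hg⟩ := hann
  set w : κ → ℝ := fun i => g (Pi.single i 1) with hw
  have hgf : ∀ y, P y ⬝ᵥ w = (Mᵀ *ᵥ y) ⬝ᵥ h := by
    intro y
    rw [hw, ← hrep, ← hf]
    exact LinearMap.congr_fun hg y
  have hMk : M *ᵥ (h - D w) = 0 := by
    refine hker _ fun y => ?_
    rw [dotProduct_sub, ← hPdot, hgf, sub_self]
  have hwu : u ≤ ∑ i, D w i := by
    have := hfE (Mᵀ *ᵥ y₀) ⟨y₀, hy₀, rfl⟩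
    rwa [hf, ← hgf, hy₀, hedot] at this
  have hkne : h - D w ≠ 0 := by
    intro hk
    have hzero : ∀ i, D w i = 0 := by
      intro i
      by_cases hi : J i
      · have := congrFun hk i
        simp only [Pi.sub_apply, hJ i hi, Pi.zero_apply] at this
        linarith
      · rw [hD, if_neg hi]
    simp only [hzero, Finset.sum_const_zero] at hwu
    linarith
  have := hM _ hMk (fun i hi => by
    rw [Pi.sub_apply, hD, if_neg hi, sub_zero]; exact hoff i hi) hkne
  simp only [Pi.sub_apply, Finset.sum_sub_distrib] at this
  linarith

/-- A direction that is nonnegative wherever `x` is not positive is feasible at `x ≥ 0`. -/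
theorem exists_pos_nonneg_add_smul {κ : Type*} [Finite κ] {x k : κ → ℝ} (hx : 0 ≤ x)
    (hk : ∀ i, ¬ 0 < x i → 0 ≤ k i) : ∃ t : ℝ, 0 < t ∧ 0 ≤ x + t • k := by
  have h : ∀ᶠ t in nhdsWithin (0 : ℝ) (Set.Ioi 0), ∀ i, 0 ≤ x i + t * k i := by
    rw [Filter.eventually_all]
    intro i
    by_cases hi : 0 < x i
    · have hc : Continuous fun t : ℝ => x i + t * k i := by fun_prop
      have : ∀ᶠ t in nhds (0 : ℝ), 0 < x i + t * k i :=
        hc.continuousAt.eventually (lt_mem_nhds (by simpa using hi))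
      exact (this.filter_mono nhdsWithin_le_nhds).mono fun t ht => ht.le
    · filter_upwards [self_mem_nhdsWithin] with t ht
      exact add_nonneg (hx i) (mul_nonneg (le_of_lt ht) (hk i hi))
  obtain ⟨t, ht, ht0⟩ := (h.and self_mem_nhdsWithin).exists
  exact ⟨t, ht0, fun i => by simpa using ht i⟩

theorem stmt_12 {m n : ℕ} (A : Matrix (Fin m) (Fin n) ℝ) (b : Fin m → ℝ)
    (c : Fin n → ℝ) (dstar : ℝ)
    (hlb : ∀ z : Fin n → ℝ, A.mulVec z = b → 0 ≤ z → dstar ≤ c ⬝ᵥ z)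
    (x : Fin n → ℝ) (hAx : A.mulVec x = b) (hx : 0 ≤ x) (hcx : c ⬝ᵥ x = dstar) :
    (∀ z : Fin n → ℝ, A.mulVec z = b → c ⬝ᵥ z = dstar → 0 ≤ z → z ≠ x →
        ∑ i, |x i| < ∑ i, |z i|) ↔
      (LinearIndependent ℝ (fun j : {i : Fin n // 0 < x i} =>
          (Sum.elim (fun k : Fin m => A k j.1) (fun _ : Unit => c j.1) :
            Fin m ⊕ Unit → ℝ)) ∧
       ∃ η : Fin n → ℝ,
         (∃ (u : Fin m → ℝ) (β : ℝ), η = A.transpose.mulVec u + β • c) ∧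
         (∀ i, 0 < x i → η i = 1) ∧ (∀ i, ¬ 0 < x i → η i < 1)) := by
  classical
  have habs : ∀ z : Fin n → ℝ, 0 ≤ z → ∑ i, |z i| = ∑ i, z i := fun z hz =>
    Finset.sum_congr rfl fun i _ => abs_of_nonneg (hz i)
  -- linear combinations of the columns in the support, written with vectors supported there
  have hLI : LinearIndependent ℝ (fun j : {i : Fin n // 0 < x i} =>
      (Sum.elim (fun k : Fin m => A k j.1) (fun _ : Unit => c j.1) : Fin m ⊕ Unit → ℝ)) ↔
      ∀ k : Fin n → ℝ, A *ᵥ k = 0 → c ⬝ᵥ k = 0 → (∀ i, ¬ 0 < x i → k i = 0) → k = 0 := by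
    have hsub : ∀ (r k : Fin n → ℝ), (∀ i, ¬ 0 < x i → k i = 0) →
        ∑ j : {i : Fin n // 0 < x i}, k j * r j = r ⬝ᵥ k := by
      intro r k hk
      rw [dotProduct, ← Finset.sum_subtype (Finset.univ.filter fun i => 0 < x i) (by simp)
        (fun i => k i * r i), Finset.sum_filter]
      refine Finset.sum_congr rfl fun i _ => ?_
      split_ifs with hi
      · ring
      · simp [hk i hi]
    rw [Fintype.linearIndependent_iff]
    constructor
    · intro H k hA hc hk
      have := H (fun j => k j) (by
        ext l
        rcases l with l | l
        · simpa [Finset.sum_apply] using (hsub (A l) k hk).trans (congrFun hA l)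
        · simpa [Finset.sum_apply] using (hsub c k hk).trans hc)
      ext i
      by_cases hi : 0 < x i
      · exact this ⟨i, hi⟩
      · exact hk i hi
    · intro H g hg j
      let k : Fin n → ℝ := fun i => if hi : 0 < x i then g ⟨i, hi⟩ else 0
      have hkj : ∀ j : {i : Fin n // 0 < x i}, k j = g j := fun j => by simp [k, j.2]
      have hk : ∀ i, ¬ 0 < x i → k i = 0 := fun i hi => by simp [k, hi]
      have := H k
        (by
          ext l
          have := congrFun hg (Sum.inl l)
          change A l ⬝ᵥ k = 0
          simpa [Finset.sum_apply, ← hkj, hsub (A l) k hk] using this)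
        (by
          have := congrFun hg (Sum.inr ())
          simpa [Finset.sum_apply, ← hkj, hsub c k hk] using this) hk
      rw [← hkj, this]
      rfl
  rw [hLI]
  constructor
  · intro H
    have hpos : ∀ k : Fin n → ℝ, A *ᵥ k = 0 → c ⬝ᵥ k = 0 → (∀ i, ¬ 0 < x i → 0 ≤ k i) →
        k ≠ 0 → 0 < ∑ i, k i := by
      intro k hA hc hk hne
      obtain ⟨t, ht, htk⟩ := exists_pos_nonneg_add_smul hx hk
      have := H (x + t • k) (by rw [mulVec_add, mulVec_smul, hA, hAx, smul_zero, add_zero])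
        (by rw [dotProduct_add, dotProduct_smul, hc, hcx, smul_zero, add_zero]) htk
        (by simpa using ⟨ht.ne', hne⟩)
      rw [habs x hx, habs _ htk] at this
      simp only [Pi.add_apply, Pi.smul_apply, smul_eq_mul, Finset.sum_add_distrib,
        ← Finset.mul_sum, lt_add_iff_pos_right] at this
      exact pos_of_mul_pos_right this ht.le
    constructor
    · intro k hA hc hk
      by_contra hne
      have h1 := hpos k hA hc (fun i hi => (hk i hi).ge) hne
      have h2 := hpos (-k) (by rw [mulVec_neg, hA, neg_zero]) (by rw [dotProduct_neg, hc, neg_zero])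
        (fun i hi => by simp [hk i hi]) (neg_ne_zero.mpr hne)
      simp only [Pi.neg_apply, Finset.sum_neg_distrib] at h2
      linarith
    · obtain ⟨y, hy1, hy2⟩ := exists_transpose_mulVec_eq_one_lt_one
        (fromRows A (replicateRow Unit c)) (fun i => 0 < x i) (by
          intro k hk
          rw [fromRows_mulVec] at hk
          exact hpos k (funext fun l => congrFun hk (Sum.inl l)) (congrFun hk (Sum.inr ())))
      refine ⟨_, ⟨fun l => y (Sum.inl l), y (Sum.inr ()), ?_⟩, hy1, hy2⟩
      ext i
      simp [mulVec, dotProduct, mul_comm]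
  · rintro ⟨hinj, η, ⟨u, β, hη⟩, hη1, hη2⟩ z hAz hcz hz hne
    have hAk : A *ᵥ (z - x) = 0 := by rw [mulVec_sub, hAz, hAx, sub_self]
    have hck : c ⬝ᵥ (z - x) = 0 := by rw [dotProduct_sub, hcz, hcx, sub_self]
    have hηk : η ⬝ᵥ (z - x) = 0 := by
      rw [hη, add_dotProduct, smul_dotProduct, hck, mulVec_transpose, ← dotProduct_mulVec, hAk]
      simp
    have hx0 : ∀ i, ¬ 0 < x i → x i = 0 := fun i hi => le_antisymm (not_lt.mp hi) (hx i)
    have hnonneg : ∀ i, 0 ≤ (1 - η i) * (z i - x i) := by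
      intro i
      by_cases hi : 0 < x i
      · simp [hη1 i hi]
      · rw [hx0 i hi, sub_zero]
        exact mul_nonneg (sub_nonneg.mpr (hη2 i hi).le) (hz i)
    have hsum : ∑ i, (1 - η i) * (z i - x i) = ∑ i, z i - ∑ i, x i := by
      simp only [dotProduct, Pi.sub_apply] at hηk
      simp only [sub_mul, one_mul, Finset.sum_sub_distrib, hηk, sub_zero]
    rw [habs x hx, habs z hz, ← sub_pos, ← hsum]
    refine (Finset.sum_nonneg fun i _ => hnonneg i).lt_of_ne' fun h0 => ?_
    rw [Finset.sum_eq_zero_iff_of_nonneg fun i _ => hnonneg i] at h0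
    refine hne (sub_eq_zero.mp (hinj _ hAk hck fun i hi => ?_))
    exact (mul_eq_zero.mp (h0 i (Finset.mem_univ i))).resolve_left (sub_pos.mpr (hη2 i hi)).ne'
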